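/- Let Ē₁ and Ē₂ be nonzero euclidean lattices with μ_max(Ē₁) ≤ 0 and μ_max(Ē₂) ≤ 0 (equivalently: every nonzero sublattice of Ē₁ and of Ē₂, with the induced inner product, has covolume ≥ 1). Then every nonzero ℤ-submodule Ē of Ē₁ ⊗ Ē₂ of rank r, equipped with the induced inner product, has covolume vol(Ē) ≥ r^{−r/2}; equivalently μ(Ē) ≤ (1/2)·log r. -/

import Mathlib

noncomputable section

/-- The covolume of a euclidean lattice presented by the Gram matrix `B` of a `ℤ`-basis:
the square root of the Gram determinant. -/
def latVol {ι : Type} [Fintype ι] [DecidableEq ι] (B : Matrix ι ι ℝ) : ℝ :=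
  Real.sqrt B.det

/-- The arithmetic degree of a euclidean lattice: `- log` of its covolume. -/
def latDeg {ι : Type} [Fintype ι] [DecidableEq ι] (B : Matrix ι ι ℝ) : ℝ :=
  - Real.log (latVol B)

/-- The slope of a euclidean lattice: degree divided by rank. -/
def latMu {ι : Type} [Fintype ι] [DecidableEq ι] (B : Matrix ι ι ℝ) : ℝ :=
  latDeg B / (Fintype.card ι)

/-- The Gram matrix (for the induced inner product) of the rank-`s` sublattice whose
`ℤ`-basis consists of the columns of the integer matrix `A`, inside the lattice with
Gram matrix `B`. -/
def inducedGram {ι : Type} [Fintype ι] (B : Matrix ι ι ℝ) {s : ℕ}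
    (A : Matrix ι (Fin s) ℤ) : Matrix (Fin s) (Fin s) ℝ :=
  (A.map (Int.cast : ℤ → ℝ)).transpose * B * A.map (Int.cast : ℤ → ℝ)

/-- The maximal slope `μ_max` of a euclidean lattice: the supremum of the slopes of its
nonzero sublattices (of any rank), each equipped with the induced inner product.  A nonzero
sublattice is presented by a `ℤ`-basis, i.e. by the columns of an integer matrix `A` which
are linearly independent over `ℤ`. -/
def latMuMax {ι : Type} [Fintype ι] [DecidableEq ι] (B : Matrix ι ι ℝ) : ℝ :=
  sSup { m : ℝ | ∃ (s : ℕ) (A : Matrix ι (Fin s) ℤ), 0 < s ∧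
    LinearIndependent ℤ (fun k : Fin s => fun i : ι => A i k) ∧
    m = latMu (inducedGram B A) }

end

open scoped Matrix

/-- A nonzero integer matrix has a rank factorization over `ℤ`. -/
theorem exists_int_rank_factorization {m n : Type*} [Fintype m] [Fintype n] [DecidableEq n]
    (X : Matrix m n ℤ) (hX : X ≠ 0) :
    ∃ (k : ℕ) (P : Matrix m (Fin k) ℤ) (Q : Matrix n (Fin k) ℤ), 0 < k ∧
      LinearIndependent ℤ (fun j i => P i j) ∧ LinearIndependent ℤ (fun j i => Q i j) ∧
      X = P * Qᵀ := by
  classical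
  obtain ⟨k, ⟨b⟩⟩ :=
    Submodule.nonempty_basis_of_pid (Pi.basisFun ℤ m) (LinearMap.range X.mulVecLin)
  have hfac : X = (Matrix.of fun i j => (b j : m → ℤ) i) *
      (Matrix.of fun i j => b.repr (X.mulVecLin.rangeRestrict (Pi.single i 1)) j)ᵀ := by
    ext i j
    have h := congrFun (congrArg Subtype.val
      (b.sum_repr (X.mulVecLin.rangeRestrict (Pi.single j 1)))) i
    simp only [AddSubmonoidClass.coe_finsetSum, Submodule.coe_smul, LinearMap.codRestrict_apply,
      LinearMap.rangeRestrict, Finset.sum_apply, Pi.smul_apply, smul_eq_mul, Matrix.mulVecLin_apply,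
      Matrix.mulVec_single_one, Matrix.col_apply] at h
    simp only [Matrix.mul_apply, Matrix.of_apply, Matrix.transpose_apply, LinearMap.rangeRestrict]
    rw [← h]
    exact Finset.sum_congr rfl fun _ _ => mul_comm _ _
  refine ⟨k, _, _, ?_, ?_, ?_, hfac⟩
  · rcases Nat.eq_zero_or_pos k with rfl | hk
    · refine absurd ?_ hX
      rw [hfac]
      ext i j
      simp [Matrix.mul_apply]
    · exact hk
  · exact b.linearIndependent.map' (LinearMap.range X.mulVecLin).subtype (Submodule.ker_subtype _)
  · rw [Fintype.linearIndependent_iff]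
    intro c hc j
    have hzero : (b.constr ℤ c) ∘ₗ X.mulVecLin.rangeRestrict = 0 := by
      refine LinearMap.pi_ext' fun i => LinearMap.ext_ring ?_
      have h := congrFun hc i
      simp only [Finset.sum_apply, Pi.smul_apply, smul_eq_mul, Matrix.of_apply,
        Pi.zero_apply] at h
      simp only [LinearMap.comp_apply, LinearMap.single_apply, Module.Basis.constr_apply_fintype,
        LinearMap.zero_apply, Module.Basis.equivFun_apply, smul_eq_mul]
      rw [← h]
      exact Finset.sum_congr rfl fun _ _ => mul_comm _ _
    obtain ⟨y, hy⟩ := X.mulVecLin.surjective_rangeRestrict (b j)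
    have h := LinearMap.congr_fun hzero y
    rwa [LinearMap.comp_apply, hy, b.constr_basis] at h

/-- The columns of an integer matrix that are independent over `ℤ` stay independent over `ℝ`. -/
theorem mulVec_map_intCast_injective {m n : Type*} [Finite m] [Fintype n] {A : Matrix m n ℤ}
    (hA : LinearIndependent ℤ (fun k i => A i k)) :
    Function.Injective (A.map (Int.cast : ℤ → ℝ)).mulVec := by
  rw [Matrix.mulVec_injective_iff]
  convert! (linearIndependent_algebraMap_comp_iff (R := ℤ) (S := ℝ)
    (v := fun k i => A i k)).2 hA using 1

theorem Matrix.PosSemidef.exists_eq_transpose_mul_self {n : Type*} [Fintype n] [DecidableEq n]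
    {G : Matrix n n ℝ} (hG : G.PosSemidef) : ∃ M : Matrix n n ℝ, G = Mᵀ * M := by
  open scoped MatrixOrder in
  obtain ⟨M, hM⟩ := CStarAlgebra.nonneg_iff_eq_star_mul_self.mp hG.nonneg
  exact ⟨M, by rw [hM, Matrix.star_eq_conjTranspose, Matrix.conjTranspose_eq_transpose_of_trivial]⟩

/-- A positive semidefinite matrix of positive size and determinant at least one has trace at
least one. -/
theorem Matrix.PosSemidef.one_le_trace {n : Type*} [Fintype n] [DecidableEq n] [Nonempty n]
    {N : Matrix n n ℝ} (hN : N.PosSemidef) (hdet : 1 ≤ N.det) : 1 ≤ N.trace := by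
  have hd := hN.isHermitian.det_eq_prod_eigenvalues
  have ht := hN.isHermitian.trace_eq_sum_eigenvalues
  simp only [RCLike.ofReal_real_eq_id, id_eq] at hd ht
  rw [hd] at hdet
  rw [ht]
  by_contra! hlt
  have hev : ∀ i, hN.isHermitian.eigenvalues i < 1 := fun i =>
    (Finset.single_le_sum (fun j _ => hN.eigenvalues_nonneg j) (Finset.mem_univ i)).trans_lt hlt
  obtain ⟨i⟩ := ‹Nonempty n›
  have hrest : ∏ j ∈ Finset.univ.erase i, hN.isHermitian.eigenvalues j ≤ 1 :=
    Finset.prod_le_one (fun j _ => hN.eigenvalues_nonneg j) (fun j _ => (hev j).le)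
  rw [← Finset.mul_prod_erase _ _ (Finset.mem_univ i)] at hdet
  nlinarith [hev i, hN.eigenvalues_nonneg i,
    mul_le_of_le_one_right (hN.eigenvalues_nonneg i) hrest]

theorem Matrix.PosSemidef.one_le_trace_mul {n : Type*} [Fintype n] [DecidableEq n] [Nonempty n]
    {G H : Matrix n n ℝ} (hG : G.PosSemidef) (hH : H.PosSemidef)
    (hGdet : 1 ≤ G.det) (hHdet : 1 ≤ H.det) : 1 ≤ (G * H).trace := by
  obtain ⟨M, rfl⟩ := hH.exists_eq_transpose_mul_self
  rw [← Matrix.mul_assoc, Matrix.trace_mul_comm, ← Matrix.mul_assoc]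
  apply Matrix.PosSemidef.one_le_trace
  · simpa using hG.mul_mul_conjTranspose_same M
  · rw [Matrix.det_mul, Matrix.det_transpose] at hHdet
    rw [Matrix.det_mul, Matrix.det_mul, Matrix.det_transpose]
    nlinarith

theorem inducedGram_posSemidef {ι : Type} [Fintype ι] {B : Matrix ι ι ℝ} (hB : B.PosSemidef)
    {s : ℕ} (A : Matrix ι (Fin s) ℤ) : (inducedGram B A).PosSemidef := by
  simpa [inducedGram, Matrix.conjTranspose_eq_transpose_of_trivial] using
    hB.conjTranspose_mul_mul_same (A.map (Int.cast : ℤ → ℝ))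

theorem inducedGram_posDef {ι : Type} [Fintype ι] {B : Matrix ι ι ℝ} (hB : B.PosDef)
    {s : ℕ} {A : Matrix ι (Fin s) ℤ} (hA : LinearIndependent ℤ (fun k i => A i k)) :
    (inducedGram B A).PosDef := by
  simpa [inducedGram, Matrix.conjTranspose_eq_transpose_of_trivial] using
    hB.conjTranspose_mul_mul_same (mulVec_map_intCast_injective hA)

/-- If all nonzero sublattices of two euclidean lattices have covolume at least one, then every
nonzero vector of their tensor product has norm at least one. -/
theorem one_le_kronecker_quadratic {m n : Type} [Fintype m] [Fintype n] [DecidableEq m]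
    [DecidableEq n] {B₁ : Matrix m m ℝ} {B₂ : Matrix n n ℝ}
    (hB₁ : B₁.PosSemidef) (hB₂ : B₂.PosSemidef)
    (hmax₁ : ∀ (s : ℕ) (A : Matrix m (Fin s) ℤ), 0 < s →
      LinearIndependent ℤ (fun k : Fin s => fun i => A i k) → 1 ≤ latVol (inducedGram B₁ A))
    (hmax₂ : ∀ (s : ℕ) (A : Matrix n (Fin s) ℤ), 0 < s →
      LinearIndependent ℤ (fun k : Fin s => fun i => A i k) → 1 ≤ latVol (inducedGram B₂ A))
    {x : m × n → ℤ} (hx : x ≠ 0) :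
    1 ≤ (fun p => (x p : ℝ)) ⬝ᵥ
      (Matrix.kroneckerMap (· * ·) B₁ B₂ *ᵥ fun p => (x p : ℝ)) := by
  let X : Matrix n m ℤ := Matrix.of fun j i => x (i, j)
  have hX : X ≠ 0 := fun h => hx (funext fun p => congrFun (congrFun h p.2) p.1)
  obtain ⟨k, P, Q, hk, hP, hQ, hXPQ⟩ := exists_int_rank_factorization X hX
  have hvec : (fun p => (x p : ℝ)) =
      Matrix.vec (P.map (Int.cast : ℤ → ℝ) * (Q.map (Int.cast : ℤ → ℝ))ᵀ) := by
    ext p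
    have h := congrArg (Int.cast : ℤ → ℝ) (congrFun (congrFun hXPQ p.2) p.1)
    simpa [X, Matrix.mul_apply, Matrix.vec] using h
  have : Nonempty (Fin k) := ⟨⟨0, hk⟩⟩
  have hdet : ∀ {l : Type} [Fintype l] (B : Matrix l l ℝ) (A : Matrix l (Fin k) ℤ),
      1 ≤ latVol (inducedGram B A) → 1 ≤ (inducedGram B A).det := fun B A h => by
    rwa [latVol, Real.one_le_sqrt] at h
  have key := (inducedGram_posSemidef hB₂ P).one_le_trace_mul (inducedGram_posSemidef hB₁ Q)
    (hdet _ _ (hmax₂ k P hk hP)) (hdet _ _ (hmax₁ k Q hk hQ))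
  have hsymm : B₁ᵀ = B₁ := by
    simpa [Matrix.conjTranspose_eq_transpose_of_trivial] using hB₁.isHermitian.eq
  rw [hvec]
  erw [Matrix.kronecker_mulVec_vec]
  rw [Matrix.vec_dotProduct_vec, hsymm]
  convert key using 1
  simp only [inducedGram, Matrix.transpose_mul, Matrix.transpose_transpose, Matrix.mul_assoc]
  rw [Matrix.trace_mul_comm]
  simp only [Matrix.mul_assoc]

/-- **Minkowski's bound** for the first minimum of a euclidean lattice. -/
theorem exists_int_quadratic_lt_one {s : ℕ} {G : Matrix (Fin s) (Fin s) ℝ} (hs : 0 < s)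
    (hG : G.PosDef) (hdet : Real.sqrt G.det < (s : ℝ) ^ (-(s : ℝ) / 2)) :
    ∃ v : Fin s → ℤ, v ≠ 0 ∧ (fun i => (v i : ℝ)) ⬝ᵥ (G *ᵥ fun i => (v i : ℝ)) < 1 := by
  obtain ⟨M, hM⟩ := hG.posSemidef.exists_eq_transpose_mul_self
  have : Nonempty (Fin s) := ⟨⟨0, hs⟩⟩
  have hs' : (0 : ℝ) < s := by exact_mod_cast hs
  have hMdet : G.det = M.det ^ 2 := by
    rw [hM, Matrix.det_mul, Matrix.det_transpose, sq]
  have hM0 : M.det ≠ 0 := fun h => hG.det_pos.ne' (by simp [hMdet, h])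
  rw [hMdet, Real.sqrt_sq_eq_abs] at hdet
  set δ : ℝ := (Real.sqrt s)⁻¹ with hδ
  have hδ0 : 0 < δ := by positivity
  have hδ2 : δ ^ 2 * s = 1 := by
    rw [hδ, inv_pow, Real.sq_sqrt hs'.le, inv_mul_cancel₀ hs'.ne']
  have hδs : (s : ℝ) ^ (-(s : ℝ) / 2) = δ ^ s := by
    rw [hδ, Real.sqrt_eq_rpow, ← Real.rpow_neg hs'.le, ← Real.rpow_natCast, ← Real.rpow_mul hs'.le]
    congr 1
    ring
  rw [hδs] at hdet
  let C : Set (Fin s → ℝ) := Set.univ.pi fun _ => Set.Ioo (-δ) δ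
  have hC : ∀ y, y ∈ C ↔ ∀ i, |y i| < δ := fun y => by simp [C, abs_lt]
  let S : Set (Fin s → ℝ) := Matrix.toLin' M ⁻¹' C
  have hvol : MeasureTheory.volume S =
      ENNReal.ofReal (|M.det|⁻¹ * (2 * δ) ^ s) := by
    rw [MeasureTheory.Measure.addHaar_preimage_linearMap _ (by rwa [LinearMap.det_toLin']),
      LinearMap.det_toLin', abs_inv, Real.volume_pi_Ioo, ENNReal.ofReal_mul (by positivity)]
    simp only [sub_neg_eq_add, Finset.prod_const, Finset.card_univ, Fintype.card_fin,
      ← two_mul]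
    rw [ENNReal.ofReal_pow (by positivity)]
  have : Countable (Submodule.span ℤ (Set.range (Pi.basisFun ℝ (Fin s)))).toAddSubgroup :=
    inferInstanceAs (Countable (Submodule.span ℤ (Set.range (Pi.basisFun ℝ (Fin s)))))
  obtain ⟨⟨y, hy⟩, hy0, hyS⟩ :=
    MeasureTheory.exists_ne_zero_mem_lattice_of_measure_mul_two_pow_lt_measure (s := S)
    (ZSpan.isAddFundamentalDomain' (Pi.basisFun ℝ (Fin s)) MeasureTheory.volume)
    (fun x hx => by
      simp only [S, Set.mem_preimage, map_neg, hC, Pi.neg_apply, abs_neg] at hx ⊢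
      exact hx)
    ((convex_pi fun _ _ => convex_Ioo _ _).linear_preimage _)
    (by
      rw [hvol, ZSpan.fundamentalDomain_pi_basisFun, Real.volume_pi_Ico]
      simp only [sub_zero, ENNReal.ofReal_one, Finset.prod_const_one, one_mul,
        Module.finrank_fintype_fun_eq_card, Fintype.card_fin]
      rw [← ENNReal.ofReal_ofNat, ← ENNReal.ofReal_pow (by norm_num),
        ENNReal.ofReal_lt_ofReal_iff (by positivity), mul_pow, inv_mul_eq_div,
        lt_div_iff₀ (by positivity)]
      gcongr)
  obtain ⟨v, hv⟩ : ∃ v : Fin s → ℤ, ∀ i, (v i : ℝ) = y i := by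
    have h := ((Pi.basisFun ℝ (Fin s)).mem_span_iff_repr_mem ℤ y).mp hy
    choose v hv using h
    exact ⟨v, by simpa using hv⟩
  obtain rfl : (fun i => (v i : ℝ)) = y := funext hv
  refine ⟨v, fun h => hy0 (Subtype.ext (by ext i; simp [h])), ?_⟩
  rw [hM, ← Matrix.mulVec_mulVec, Matrix.dotProduct_mulVec, Matrix.vecMul_transpose]
  have hlt : ∀ i, |(M *ᵥ fun i => (v i : ℝ)) i| < δ := (hC _).1 hyS
  calc (M *ᵥ fun i => (v i : ℝ)) ⬝ᵥ (M *ᵥ fun i => (v i : ℝ))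
      < ∑ _i : Fin s, δ ^ 2 := by
        refine Finset.sum_lt_sum_of_nonempty Finset.univ_nonempty fun i _ => ?_
        rw [← sq]
        exact sq_lt_sq' (abs_lt.1 (hlt i)).1 (abs_lt.1 (hlt i)).2
    _ = 1 := by simp [← hδ2, mul_comm]

/-- Let `Ē₁`, `Ē₂` be nonzero euclidean lattices (presented by positive
definite Gram matrices `B₁`, `B₂` of ranks `r₁, r₂ ≥ 1`) such that every nonzero sublattice
of `Ē₁` and of `Ē₂`, with the induced inner product, has covolume `≥ 1` (equivalently,
`μ_max(Ē₁) ≤ 0` and `μ_max(Ē₂) ≤ 0`).  Then every nonzero sublattice `Ē` of `Ē₁ ⊗ Ē₂`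
of rank `s` (given by a `ℤ`-basis, the columns of an integer matrix `A`) satisfies
`vol(Ē) ≥ s^(-s/2)`; equivalently, `μ(Ē) ≤ (1/2)·log s`.  The Gram matrix of `Ē₁ ⊗ Ē₂`
in the tensor product basis is the Kronecker product of `B₁` and `B₂`. -/
theorem vol_sublattice_tensor_ge (r₁ r₂ : ℕ) (h₁ : 0 < r₁) (h₂ : 0 < r₂)
    (B₁ : Matrix (Fin r₁) (Fin r₁) ℝ) (B₂ : Matrix (Fin r₂) (Fin r₂) ℝ)
    (hB₁ : B₁.PosDef) (hB₂ : B₂.PosDef)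
    (hmax₁ : ∀ (s : ℕ) (A : Matrix (Fin r₁) (Fin s) ℤ), 0 < s →
      LinearIndependent ℤ (fun k : Fin s => fun i => A i k) → 1 ≤ latVol (inducedGram B₁ A))
    (hmax₂ : ∀ (s : ℕ) (A : Matrix (Fin r₂) (Fin s) ℤ), 0 < s →
      LinearIndependent ℤ (fun k : Fin s => fun i => A i k) → 1 ≤ latVol (inducedGram B₂ A)) :
    ∀ (s : ℕ) (A : Matrix (Fin r₁ × Fin r₂) (Fin s) ℤ), 0 < s →
      LinearIndependent ℤ (fun k : Fin s => fun p => A p k) →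
      (s : ℝ) ^ (-(s : ℝ) / 2) ≤
          latVol (inducedGram (Matrix.kroneckerMap (· * ·) B₁ B₂) A) ∧
        latMu (inducedGram (Matrix.kroneckerMap (· * ·) B₁ B₂) A) ≤ (1 / 2) * Real.log s := by
  intro s A hs hA
  have hs' : (0 : ℝ) < s := by exact_mod_cast hs
  have hvol : (s : ℝ) ^ (-(s : ℝ) / 2) ≤
      latVol (inducedGram (Matrix.kroneckerMap (· * ·) B₁ B₂) A) := by
    by_contra! hlt
    obtain ⟨v, hv0, hv⟩ :=
      exists_int_quadratic_lt_one hs (inducedGram_posDef (hB₁.kronecker hB₂) hA) hlt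
    have hx : A *ᵥ v ≠ 0 := fun h => hv0 <|
      Matrix.mulVec_injective_iff.2 hA (h.trans (Matrix.mulVec_zero A).symm)
    refine hv.not_ge ((one_le_kronecker_quadratic hB₁.posSemidef hB₂.posSemidef
      hmax₁ hmax₂ hx).trans_eq ?_)
    have hcast : (fun p => ((A *ᵥ v) p : ℝ)) =
        A.map (Int.cast : ℤ → ℝ) *ᵥ fun i => (v i : ℝ) := by
      ext p
      simp [Matrix.mulVec, dotProduct]
    rw [hcast, inducedGram, ← Matrix.mulVec_mulVec, ← Matrix.mulVec_mulVec,
      Matrix.dotProduct_mulVec _ (Matrix.transpose _), Matrix.vecMul_transpose]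
  refine ⟨hvol, ?_⟩
  have hlog := Real.log_le_log (by positivity) hvol
  rw [Real.log_rpow hs'] at hlog
  rw [latMu, latDeg, Fintype.card_fin, div_le_iff₀ hs']
  linarith
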